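/- Fix integers m ≥ 1 and n ≥ 1. Let a_1,…,a_m and a'_1,…,a'_m be two families of integers, each of whose members is at least 2, and suppose each family is multiplicatively independent. Then there exists N such that for every prime q > N, the number of tuples (x_1,…,x_n) ∈ (ℤ/qℤ)^n whose coordinates are pairwise distinct and all nonzero and which satisfy x_i ≠ a_r·x_j for all i ≠ j and all 1 ≤ r ≤ m, equals the corresponding number with a_1,…,a_m replaced by a'_1,…,a'_m. -/

import Mathlib

/-- Integers `a 1, …, a m` are multiplicatively independent if the only integer
exponent vector making the product of powers (in `ℚ`) equal to `1` is zero. -/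
def MultIndepInt {m : ℕ} (a : Fin m → ℤ) : Prop :=
  ∀ e : Fin m → ℤ, (∏ r, (a r : ℚ) ^ (e r)) = 1 → ∀ r, e r = 0

inductive Reach {I V E : Type} [AddCommGroup E] (s t : I → V) (v : I → E) (T : Finset I) :
    V → V → E → Prop
  | base (k : I) (hk : k ∈ T) : Reach s t v T (s k) (t k) (v k)
  | refl (i : V) : Reach s t v T i i 0
  | symm (i j : V) (e : E) (h : Reach s t v T i j e) : Reach s t v T j i (-e)
  | trans (i j k : V) (e f : E) (h : Reach s t v T i j e) (h' : Reach s t v T j k f) :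
      Reach s t v T i k (e + f)

theorem Reach.potential {I V E : Type} [AddCommGroup E] (s t : I → V) (v : I → E) (T : Finset I)
    (hc : ∀ i e, Reach s t v T i i e → e = 0) :
    ∃ y : V → E, ∀ k ∈ T, y (s k) = v k + y (t k) := by
  let st : Setoid V :=
    { r := fun i j => ∃ e, Reach s t v T i j e
      iseqv :=
        { refl := fun i => ⟨0, Reach.refl i⟩
          symm := fun ⟨e, h⟩ => ⟨-e, Reach.symm _ _ _ h⟩
          trans := fun ⟨e, h⟩ ⟨f, h'⟩ => ⟨e + f, Reach.trans _ _ _ _ _ h h'⟩ } }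
  have hrep : ∀ i : V, ∃ e, Reach s t v T i (Quotient.out (Quotient.mk st i)) e := by
    intro i
    exact Setoid.symm (Quotient.mk_out (s := st) i)
  choose y hy using hrep
  refine ⟨y, fun k hk => ?_⟩
  have hq : Quotient.mk st (s k) = Quotient.mk st (t k) :=
    Quotient.sound ⟨v k, Reach.base k hk⟩
  have h1 := hy (s k)
  rw [hq] at h1
  have h2 := Reach.trans _ _ _ _ _ (Reach.base (s := s) (t := t) (v := v) k hk) (hy (t k))
  have h3 := hc _ _ (Reach.trans _ _ _ _ _ h1 (Reach.symm _ _ _ h2))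
  rwa [← sub_eq_add_neg, sub_eq_zero] at h3

theorem Reach.solution {I V E G : Type} [AddCommGroup E] [CommGroup G]
    (φ : Multiplicative E →* G) (s t : I → V) (v : I → E) (T : Finset I)
    (x : V → G) (hx : ∀ k ∈ T, x (s k) = φ (Multiplicative.ofAdd (v k)) * x (t k))
    (i j : V) (e : E) (h : Reach s t v T i j e) :
    x i = φ (Multiplicative.ofAdd e) * x j := by
  induction h with
  | base k hk => exact hx k hk
  | refl i => simp
  | symm i j e h ih => rw [ih]; simp
  | trans i j k e f h h' ih ih' => rw [ih, ih']; simp [mul_assoc]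

/-- The homomorphism from exponent vectors. -/
def expHom {m : ℕ} {G : Type} [CommGroup G] (u : Fin m → G) :
    Multiplicative (Fin m → ℤ) →* G where
  toFun e := ∏ r, u r ^ (Multiplicative.toAdd e r)
  map_one' := by simp
  map_mul' e f := by simp [zpow_add, Finset.prod_mul_distrib]

theorem exp_ne_one {m : ℕ} (a : Fin m → ℤ) (ha : ∀ r, 2 ≤ a r) (hind : MultIndepInt a)
    (e : Fin m → ℤ) (he : e ≠ 0) :
    ∃ N : ℕ, ∀ q : ℕ, q.Prime → N < q → ∀ u : Fin m → (ZMod q)ˣ,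
      (∀ r, (u r : ZMod q) = a r) → expHom u (Multiplicative.ofAdd e) ≠ 1 := by
  have hdec : ∀ r, e r = ((e r).toNat : ℤ) - ((-e r).toNat : ℤ) := fun r => by omega
  set A : ℤ := ∏ r, a r ^ (e r).toNat with hA
  set B : ℤ := ∏ r, a r ^ (-e r).toNat with hB
  have hAB : A - B ≠ 0 := by
    intro h
    apply he
    funext r
    refine hind e ?_ r
    have ha0 : ∀ r, (a r : ℚ) ≠ 0 := fun r => by
      have := ha r
      exact_mod_cast (by omega : a r ≠ 0)
    have : ∀ r, (a r : ℚ) ^ e r = (a r : ℚ) ^ (e r).toNat / (a r : ℚ) ^ (-e r).toNat := by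
      intro r
      conv_lhs => rw [hdec r]
      rw [zpow_sub₀ (ha0 r), zpow_natCast, zpow_natCast]
    rw [Finset.prod_congr rfl (fun r _ => this r), Finset.prod_div_distrib, div_eq_one_iff_eq]
    · have : A = B := by omega
      rw [hA, hB] at this
      exact_mod_cast this
    · exact Finset.prod_ne_zero_iff.2 fun r _ => pow_ne_zero _ (ha0 r)
  refine ⟨(A - B).natAbs, fun q hq hN u hu h => ?_⟩
  have h1 : ∏ r, u r ^ (e r).toNat = ∏ r, u r ^ (-e r).toNat := by
    have : ∀ r, u r ^ e r = u r ^ (e r).toNat / u r ^ (-e r).toNat := by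
      intro r
      conv_lhs => rw [hdec r]
      rw [zpow_sub, zpow_natCast, zpow_natCast, div_eq_mul_inv]
    have h' : ∏ r, u r ^ e r = 1 := h
    rw [Finset.prod_congr rfl (fun r _ => this r), Finset.prod_div_distrib, div_eq_one] at h'
    exact h'
  have h2 := congrArg (Units.val) h1
  simp only [Units.coe_prod, Units.val_pow_eq_pow_val, hu] at h2
  have h3 : ((A - B : ℤ) : ZMod q) = 0 := by
    rw [hA, hB]; push_cast; rw [h2, sub_self]
  rw [ZMod.intCast_zmod_eq_zero_iff_dvd] at h3
  have h4 := Int.natAbs_dvd_natAbs.2 h3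
  have := Nat.le_of_dvd (Int.natAbs_pos.2 hAB) h4
  simp at this
  omega

/-- Solutions of a single relation. -/
def relSet {I V G : Type} [CommGroup G] {m : ℕ} (u : Fin m → G) (s t : I → V)
    (v : I → (Fin m → ℤ)) (k : I) : Set (V → G) :=
  {x | x (s k) = expHom u (Multiplicative.ofAdd (v k)) * x (t k)}

theorem relCard {I V : Type} {m : ℕ} (s t : I → V)
    (v : I → (Fin m → ℤ)) (T : Finset I)
    (a a' : Fin m → ℤ) (ha : ∀ r, 2 ≤ a r) (ha' : ∀ r, 2 ≤ a' r)
    (hind : MultIndepInt a) (hind' : MultIndepInt a') :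
    ∃ N : ℕ, ∀ q : ℕ, q.Prime → N < q → ∀ u u' : Fin m → (ZMod q)ˣ,
      (∀ r, (u r : ZMod q) = a r) → (∀ r, (u' r : ZMod q) = a' r) →
      {x | ∀ k ∈ T, x ∈ relSet u s t v k}.ncard =
      {x | ∀ k ∈ T, x ∈ relSet u' s t v k}.ncard := by
  by_cases hc : ∀ i e, Reach s t v T i i e → e = 0
  · obtain ⟨y, hy⟩ := Reach.potential s t v T hc
    refine ⟨0, fun q _ _ u u' _ _ => ?_⟩
    let F : (Fin m → (ZMod q)ˣ) → V → (ZMod q)ˣ := fun u i => expHom u (Multiplicative.ofAdd (y i))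
    have hF : ∀ u, ∀ k ∈ T, F u (s k) = expHom u (Multiplicative.ofAdd (v k)) * F u (t k) := by
      intro u k hk
      simp only [F]
      rw [hy k hk, ofAdd_add, map_mul]
    refine Set.ncard_congr (fun x _ => x / F u * F u') ?_ ?_ ?_
    · intro x hx k hk
      have := hx k hk
      simp only [relSet, Set.mem_ofPred_eq, Pi.mul_apply, Pi.div_apply] at this ⊢
      rw [this, hF u k hk, hF u' k hk, mul_div_mul_left_eq_div]
      rw [mul_left_comm]
    · intro x z _ _ h
      simpa using h
    · intro z hz
      refine ⟨z / F u' * F u, ?_, by simp⟩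
      intro k hk
      have := hz k hk
      simp only [relSet, Set.mem_ofPred_eq, Pi.mul_apply, Pi.div_apply] at this ⊢
      rw [this, hF u k hk, hF u' k hk, mul_div_mul_left_eq_div]
      rw [mul_left_comm]
  · push Not at hc
    obtain ⟨i, e, hR, he⟩ := hc
    obtain ⟨N, hN⟩ := exp_ne_one a ha hind e he
    obtain ⟨N', hN'⟩ := exp_ne_one a' ha' hind' e he
    refine ⟨max N N', fun q hq hqN u u' hu hu' => ?_⟩
    have key : ∀ w : Fin m → (ZMod q)ˣ, expHom w (Multiplicative.ofAdd e) ≠ 1 →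
        {x | ∀ k ∈ T, x ∈ relSet w s t v k} = ∅ := by
      intro w hw
      rw [Set.eq_empty_iff_forall_notMem]
      intro x hx
      have := Reach.solution (expHom w) s t v T x hx i i e hR
      exact hw (by simpa using this)
    rw [key u (hN q hq (by omega) u hu), key u' (hN' q hq (by omega) u' hu')]

theorem compl_card {I X : Type} [Fintype I] [Fintype X] (S S' : I → Set X)
    (h : ∀ T : Finset I, {x | ∀ k ∈ T, x ∈ S k}.ncard = {x | ∀ k ∈ T, x ∈ S' k}.ncard) :
    {x | ∀ k, x ∉ S k}.ncard = {x | ∀ k, x ∉ S' k}.ncard := by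
  classical
  have main : ∀ S : I → Set X, ({x | ∀ k, x ∉ S k}.ncard : ℤ) =
      ∑ T ∈ (Finset.univ : Finset I).powerset, (-1 : ℤ) ^ T.card *
        ({x | ∀ k ∈ T, x ∈ S k}.ncard : ℤ) := by
    intro S
    have := Finset.inclusion_exclusion_card_inf_compl (Finset.univ : Finset I)
      (fun k => (S k).toFinset)
    have e1 : {x | ∀ k, x ∉ S k} =
        (((Finset.univ : Finset I).inf fun k => ((S k).toFinset)ᶜ : Finset X) : Set X) := by
      ext x; simp [Finset.mem_inf]
    rw [e1, Set.ncard_coe_finset, this]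
    refine Finset.sum_congr rfl fun T _ => ?_
    have e2 : {x | ∀ k ∈ T, x ∈ S k} = ((T.inf fun k => (S k).toFinset : Finset X) : Set X) := by
      ext x; simp [Finset.mem_inf]
    rw [e2, Set.ncard_coe_finset]
  have := main S
  simp only [h] at this
  rw [← main S'] at this
  exact_mod_cast this

theorem to_units {m n q : ℕ} (hq : q.Prime) (a : Fin m → ℤ) (u : Fin m → (ZMod q)ˣ)
    (hu : ∀ r, (u r : ZMod q) = a r) :
    Set.ncard {x : Fin n → ZMod q | Function.Injective x ∧ (∀ i, x i ≠ 0) ∧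
        ∀ i j, i ≠ j → ∀ r : Fin m, x i ≠ (a r : ZMod q) * x j} =
    {x : Fin n → (ZMod q)ˣ | ∀ k : {p : Fin n × Fin n // p.1 ≠ p.2} × Option (Fin m),
      x ∉ relSet u (fun k => k.1.1.1) (fun k => k.1.1.2)
        (fun k => k.2.elim 0 (fun r => Pi.single r 1)) k}.ncard := by
  have : Fact q.Prime := ⟨hq⟩
  have hnone : expHom u (Multiplicative.ofAdd 0) = 1 := by simp
  have hsome : ∀ r, expHom u (Multiplicative.ofAdd (Pi.single r 1)) = u r := by
    intro r
    change ∏ r', u r' ^ ((Pi.single r 1 : Fin m → ℤ) r') = u r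
    rw [Finset.prod_eq_single r]
    · simp
    · intro b _ hb; simp [hb]
    · simp
  rw [← Set.ncard_image_of_injective (f := fun (x : Fin n → (ZMod q)ˣ) i => (x i : ZMod q)) _
    (fun x z h => funext fun i => Units.ext (congrFun h i))]
  congr 1
  ext x
  simp only [Set.mem_ofPred_eq, Set.mem_image]
  constructor
  · rintro ⟨h1, h2, h3⟩
    refine ⟨fun i => Units.mk0 (x i) (h2 i), ?_, by simp⟩
    rintro ⟨⟨⟨i, j⟩, hij⟩, o⟩ h
    cases o with
    | none =>
      simp only [relSet, Set.mem_ofPred_eq, Option.elim, hnone, one_mul] at h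
      exact hij (h1 (by simpa using congrArg Units.val h))
    | some r =>
      simp only [relSet, Set.mem_ofPred_eq, Option.elim, hsome] at h
      exact h3 i j hij r (by simpa [hu] using congrArg Units.val h)
  · rintro ⟨z, hz, rfl⟩
    refine ⟨?_, fun i => (z i).ne_zero, ?_⟩
    · intro i j hij
      by_contra hne
      refine hz ⟨⟨⟨i, j⟩, hne⟩, none⟩ ?_
      simp only [relSet, Set.mem_ofPred_eq, Option.elim, hnone, one_mul]
      exact Units.ext hij
    · intro i j hne r h
      refine hz ⟨⟨⟨i, j⟩, hne⟩, some r⟩ ?_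
      simp only [relSet, Set.mem_ofPred_eq, Option.elim, hsome]
      exact Units.ext (by simpa [hu] using h)

theorem exists_units {m q : ℕ} (hq : q.Prime) (a : Fin m → ℤ) (ha : ∀ r, 2 ≤ a r)
    (hN : ∑ r, (a r).natAbs < q) : ∃ u : Fin m → (ZMod q)ˣ, ∀ r, (u r : ZMod q) = a r := by
  have : Fact q.Prime := ⟨hq⟩
  refine ⟨fun r => Units.mk0 (a r : ZMod q) ?_, fun r => rfl⟩
  intro h
  rw [ZMod.intCast_zmod_eq_zero_iff_dvd] at h
  have h4 := Int.natAbs_dvd_natAbs.2 h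
  have h5 := Nat.le_of_dvd (Int.natAbs_pos.2 (by have := ha r; omega)) h4
  have h6 := Finset.single_le_sum (f := fun r => (a r).natAbs) (fun _ _ => Nat.zero_le _)
    (Finset.mem_univ r)
  simp at h5 h6
  omega

theorem stmt_1 (m n : ℕ) (hm : 1 ≤ m) (hn : 1 ≤ n)
    (a a' : Fin m → ℤ) (ha : ∀ r, 2 ≤ a r) (ha' : ∀ r, 2 ≤ a' r)
    (hind : MultIndepInt a) (hind' : MultIndepInt a') :
    ∃ N : ℕ, ∀ q : ℕ, q.Prime → N < q →
      Set.ncard {x : Fin n → ZMod q | Function.Injective x ∧ (∀ i, x i ≠ 0) ∧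
        ∀ i j, i ≠ j → ∀ r : Fin m, x i ≠ (a r : ZMod q) * x j} =
      Set.ncard {x : Fin n → ZMod q | Function.Injective x ∧ (∀ i, x i ≠ 0) ∧
        ∀ i j, i ≠ j → ∀ r : Fin m, x i ≠ (a' r : ZMod q) * x j} := by
  classical
  have key := fun T : Finset ({p : Fin n × Fin n // p.1 ≠ p.2} × Option (Fin m)) =>
    relCard (fun k => k.1.1.1) (fun k => k.1.1.2)
      (fun k => k.2.elim 0 (fun r => Pi.single r 1)) T a a' ha ha' hind hind'
  choose N hN using key
  refine ⟨∑ T, N T + ∑ r, (a r).natAbs + ∑ r, (a' r).natAbs, fun q hq hqN => ?_⟩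
  have : Fact q.Prime := ⟨hq⟩
  obtain ⟨u, hu⟩ := exists_units hq a ha (by omega)
  obtain ⟨u', hu'⟩ := exists_units hq a' ha' (by omega)
  rw [to_units hq a u hu, to_units hq a' u' hu']
  refine compl_card _ _ fun T => hN T q hq ?_ u u' hu hu'
  have h6 := Finset.single_le_sum (f := N) (fun _ _ => Nat.zero_le _) (Finset.mem_univ T)
  omega
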